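/- arXiv:1107.2554 — 2 statements merged into one kernel-verified Lean document; each statement's English description precedes it below -/
import Mathlib

section
/- Let G=(V,E) be a connected graph with nonnegative integer weights w(v) on vertices, and let p be a positive integer such that w(v) ≤ p for all v. Then there exists a partition 𝒢 of V into groups, and for each group U ∈ 𝒢 an associated subtree T_U of G, such that: (1) for each U ∈ 𝒢, p ≤ w(U) ≤ 3p where w(U) = Σ_{v∈U} w(v); (2) T_U contains all vertices of U; and (3) the trees {T_U} are pairwise edge-disjoint. (This assumes the total weight w(V) ≥ p.) -/
open Finset

namespace SimpleGraph

variable {V : Type*} {G : SimpleGraph V}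

/-- A connected subgraph has a spanning tree. -/
theorem Subgraph.Connected.exists_isTree_le {H : G.Subgraph} (hH : H.Connected) [Finite V] :
    ∃ T ≤ H, T.verts = H.verts ∧ T.Connected ∧ T.coe.IsAcyclic := by
  obtain ⟨T, hle, hT⟩ := SimpleGraph.Connected.exists_isTree_le hH.coe
  let K : G.Subgraph :=
    { verts := H.verts
      Adj := fun a b => ∃ (ha : a ∈ H.verts) (hb : b ∈ H.verts), T.Adj ⟨a, ha⟩ ⟨b, hb⟩
      adj_sub := fun ⟨_, _, h⟩ => H.adj_sub (hle h)
      edge_vert := fun ⟨ha, _, _⟩ => ha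
      symm := ⟨fun _ _ ⟨ha, hb, h⟩ => ⟨hb, ha, h.symm⟩⟩ }
  have hK : K.coe = T := by
    ext a b
    exact ⟨fun ⟨_, _, h⟩ => h, fun h => ⟨a.2, b.2, h⟩⟩
  refine ⟨K, ⟨le_rfl, fun _ _ ⟨_, _, h⟩ => hle h⟩, rfl, ⟨?_⟩, ?_⟩
  · rw [hK]; exact hT.connected
  · rw [hK]; exact hT.isAcyclic

/-- `G.RootedJoin A r`: the set `A` with root `r` is obtained from single vertices by repeatedly
joining two disjoint rooted sets along an edge between their roots. -/
inductive RootedJoin [DecidableEq V] (G : SimpleGraph V) : Finset V → V → Prop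
  | single (v : V) : RootedJoin G {v} v
  | join {A B : Finset V} {v c : V} (hA : RootedJoin G A v) (hB : RootedJoin G B c)
      (hAB : Disjoint A B) (h : G.Adj v c) : RootedJoin G (A ∪ B) v

namespace RootedJoin

variable [DecidableEq V] {A : Finset V} {v : V}

theorem root_mem (h : G.RootedJoin A v) : v ∈ A := by
  induction h with
  | single v => simp
  | join _ _ _ _ ih _ => exact mem_union_left _ ih

theorem insert {u x : V} (h : G.RootedJoin A v) (hu : u ∈ A) (hx : x ∉ A)
    (hux : G.Adj u x) : G.RootedJoin (insert x A) v := by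
  induction h with
  | single v =>
    obtain rfl := mem_singleton.1 hu
    have := (single (G := G) u).join (single x) (by simpa using hux.ne) hux
    rwa [union_comm] at this
  | @join A B v c hA hB hAB hvc ihA ihB =>
    rw [mem_union, not_or] at hx
    rcases mem_union.1 hu with hu | hu
    · rw [← insert_union]
      exact (ihA hu hx.1).join hB (disjoint_insert_left.2 ⟨hx.2, hAB⟩) hvc
    · rw [← union_insert]
      exact hA.join (ihB hu hx.2) (disjoint_insert_right.2 ⟨hx.1, hAB⟩) hvc

end RootedJoin

theorem Connected.rootedJoin_univ [Fintype V] [DecidableEq V] (hG : G.Connected) (r : V) :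
    G.RootedJoin Finset.univ r := by
  obtain ⟨A, hA, hmax⟩ := (Set.toFinite {A | G.RootedJoin A r}).exists_maximal
    ⟨{r}, RootedJoin.single r⟩
  by_cases h : A = Finset.univ
  · exact h ▸ hA
  obtain ⟨y, hy⟩ : ∃ y, y ∉ A := by simpa [Finset.eq_univ_iff_forall] using h
  obtain ⟨P⟩ := hG.preconnected r y
  obtain ⟨d, -, hd, hd'⟩ := P.exists_boundary_dart (A : Set V) hA.root_mem hy
  exact absurd (hmax (hA.insert hd hd' d.adj) (Finset.subset_insert _ _)
    (Finset.mem_insert_self _ _)) hd'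

/-- A group of vertices together with a subgraph meant to span it. -/
abbrev Group (G : SimpleGraph V) := Finset V × G.Subgraph

namespace Group

/-- Two groups are apart if they share no vertices and their subgraphs share no edges. -/
def Apart (q q' : G.Group) : Prop :=
  Disjoint q.1 q'.1 ∧ Disjoint q.2.edgeSet q'.2.edgeSet

theorem Apart.symm {q q' : G.Group} (h : q.Apart q') : q'.Apart q :=
  ⟨h.1.symm, h.2.symm⟩

instance symm_apart : Std.Symm (Apart (G := G)) := ⟨fun _ _ => Apart.symm⟩

/-- The subgraph of the group is connected, covers the group and stays inside `A`. -/
structure SpannedIn (A : Set V) (q : G.Group) : Prop where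
  connected : q.2.Connected
  subset : ↑q.1 ⊆ q.2.verts
  verts_subset : q.2.verts ⊆ A

theorem SpannedIn.mono {A B : Set V} {q : G.Group} (h : q.SpannedIn A) (hAB : A ⊆ B) :
    q.SpannedIn B :=
  ⟨h.connected, h.subset, h.verts_subset.trans hAB⟩

theorem SpannedIn.apart {A B : Set V} {q q' : G.Group} (h : q.SpannedIn A)
    (h' : q'.SpannedIn B) (hAB : Disjoint A B) : q.Apart q' := by
  have hv : Disjoint q.2.verts q'.2.verts := hAB.mono h.verts_subset h'.verts_subset
  refine ⟨Finset.disjoint_coe.1 (hv.mono h.subset h'.subset), Set.disjoint_left.2 ?_⟩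
  intro e
  induction e with
  | _ a b => exact fun hab hab' => Set.disjoint_left.1 hv (q.2.edge_vert hab) (q'.2.edge_vert hab')

/-- A group apart from two others is apart from their union. -/
theorem Apart.sup [DecidableEq V] {q q₁ q₂ : G.Group} (h₁ : q.Apart q₁) (h₂ : q.Apart q₂) :
    q.Apart (q₁.1 ∪ q₂.1, q₁.2 ⊔ q₂.2) :=
  ⟨disjoint_union_right.2 ⟨h₁.1, h₂.1⟩, by
    rw [Subgraph.edgeSet_sup]; exact disjoint_sup_right.2 ⟨h₁.2, h₂.2⟩⟩

theorem SpannedIn.sup [DecidableEq V] {A : Set V} {q q' : G.Group} (h : q.SpannedIn A)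
    (h' : q'.SpannedIn A) (hne : (q.2.verts ∩ q'.2.verts).Nonempty) :
    SpannedIn A (G := G) (q.1 ∪ q'.1, q.2 ⊔ q'.2) where
  connected := Subgraph.connected_sup h.connected.preconnected h'.connected.preconnected hne
  subset := by
    rw [coe_union, Subgraph.verts_sup]
    exact Set.union_subset_union h.subset h'.subset
  verts_subset := by
    rw [Subgraph.verts_sup]
    exact Set.union_subset h.verts_subset h'.verts_subset

theorem SpannedIn.apart_edge {A : Set V} {q : G.Group} (h : q.SpannedIn A) {a b : V}
    (hab : G.Adj a b) (hn : ¬ (a ∈ A ∧ b ∈ A)) : q.Apart (∅, G.subgraphOfAdj hab) := by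
  refine ⟨disjoint_empty_right _, ?_⟩
  rw [edgeSet_subgraphOfAdj, Set.disjoint_singleton_right]
  intro he
  exact hn ⟨h.verts_subset (q.2.edge_vert he), h.verts_subset (q.2.edge_vert he.symm)⟩

end Group

/-- A grouping of the vertices of `A` rooted at `v` into groups `𝒞` of weight in `[p, 2p)` and a
remainder `q` of weight less than `b` whose subgraph contains `v` and, unless `𝒞` is empty, meets
the subgraph of one of the groups. -/
structure IsPartialGrouping (G : SimpleGraph V) (w : V → ℕ) (p b : ℕ) (A : Finset V) (v : V)
    (𝒞 : Set G.Group) (q : G.Group) : Prop where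
  weight : ∀ g ∈ 𝒞, p ≤ ∑ x ∈ g.1, w x ∧ ∑ x ∈ g.1, w x < 2 * p
  spanned : ∀ g ∈ 𝒞, g.SpannedIn ↑A
  pairwise : 𝒞.Pairwise Group.Apart
  rem_weight : ∑ x ∈ q.1, w x < b
  rem_spanned : q.SpannedIn ↑A
  root_mem : v ∈ q.2.verts
  apart : ∀ g ∈ 𝒞, g.Apart q
  cover : ∀ x ∈ A, x ∈ q.1 ∨ ∃ g ∈ 𝒞, x ∈ g.1
  touch : 𝒞 = ∅ ∨ ∃ g ∈ 𝒞, (g.2.verts ∩ q.2.verts).Nonempty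

namespace IsPartialGrouping

variable {w : V → ℕ} {p : ℕ} {A B : Finset V} {v c : V}

theorem exists_rem_lt {𝒞 : Set G.Group} {q : G.Group} (hp : 0 < p)
    (h : G.IsPartialGrouping w p (2 * p) A v 𝒞 q) :
    ∃ 𝒞' q', G.IsPartialGrouping w p p A v 𝒞' q' := by
  by_cases hq : ∑ x ∈ q.1, w x < p
  · exact ⟨𝒞, q, { h with rem_weight := hq }⟩
  refine ⟨Insert.insert q 𝒞, (∅, G.singletonSubgraph v), ?_, ?_, ?_, by simpa, ?_, by simp, ?_,
    ?_, ?_⟩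
  · rintro g (rfl | hg)
    exacts [⟨not_lt.1 hq, h.rem_weight⟩, h.weight g hg]
  · rintro g (rfl | hg)
    exacts [h.rem_spanned, h.spanned g hg]
  · exact Set.pairwise_insert_of_symm.2
      ⟨h.pairwise, fun g hg _ => (h.apart g hg).symm⟩
  · exact ⟨Subgraph.singletonSubgraph_connected, by simp,
      by simpa using h.rem_spanned.verts_subset h.root_mem⟩
  · intro g _
    exact ⟨disjoint_empty_right _, by simp⟩
  · intro x hx
    rcases h.cover x hx with hx | ⟨g, hg, hx⟩
    exacts [.inr ⟨q, .inl rfl, hx⟩, .inr ⟨g, .inr hg, hx⟩]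
  · exact .inr ⟨q, .inl rfl, v, h.root_mem, rfl⟩

theorem single (hp : 0 < p) (hw : w v ≤ p) :
    G.IsPartialGrouping w p (2 * p) {v} v ∅ ({v}, G.singletonSubgraph v) where
  weight := by simp
  spanned := by simp
  pairwise := Set.pairwise_empty _
  rem_weight := by simp; omega
  rem_spanned := ⟨Subgraph.singletonSubgraph_connected, by simp, by simp⟩
  root_mem := by simp
  apart := by simp
  cover := by simp
  touch := .inl rfl

theorem join [DecidableEq V] {𝒞 𝒟 : Set G.Group} {q r : G.Group}
    (hA : G.IsPartialGrouping w p p A v 𝒞 q) (hB : G.IsPartialGrouping w p p B c 𝒟 r)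
    (hAB : Disjoint A B) (h : G.Adj v c) :
    G.IsPartialGrouping w p (2 * p) (A ∪ B) v (𝒞 ∪ 𝒟)
      (q.1 ∪ (∅ ∪ r.1), q.2 ⊔ (G.subgraphOfAdj h ⊔ r.2)) := by
  have hd : Disjoint (A : Set V) B := disjoint_coe.2 hAB
  have hvA := hA.rem_spanned.verts_subset hA.root_mem
  have hcB := hB.rem_spanned.verts_subset hB.root_mem
  have hcA : c ∉ (A : Set V) := Set.disjoint_right.1 hd hcB
  have hvB : v ∉ (B : Set V) := Set.disjoint_left.1 hd hvA
  have hsA : (A : Set V) ⊆ ↑(A ∪ B) := by simp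
  have hsB : (B : Set V) ⊆ ↑(A ∪ B) := by simp
  have hedge : Group.SpannedIn (G := G) ↑(A ∪ B) (∅, G.subgraphOfAdj h) :=
    ⟨Subgraph.subgraphOfAdj_connected h, by simp, by
      simpa [Set.insert_subset_iff] using ⟨Or.inl hvA, Or.inr hcB⟩⟩
  refine ⟨?_, ?_, ?_, ?_, ?_, .inl hA.root_mem, ?_, ?_, ?_⟩
  · rintro g (hg | hg)
    exacts [hA.weight g hg, hB.weight g hg]
  · rintro g (hg | hg)
    exacts [(hA.spanned g hg).mono hsA, (hB.spanned g hg).mono hsB]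
  · exact Set.pairwise_union_of_symm.2
      ⟨hA.pairwise, hB.pairwise, fun g hg g' hg' _ =>
        (hA.spanned g hg).apart (hB.spanned g' hg') hd⟩
  · rw [empty_union, sum_union (hA.rem_spanned.apart hB.rem_spanned hd).1]
    have := hA.rem_weight
    have := hB.rem_weight
    omega
  · exact (hA.rem_spanned.mono hsA).sup
      (hedge.sup (hB.rem_spanned.mono hsB) ⟨c, by simp, hB.root_mem⟩)
      ⟨v, hA.root_mem, by simp⟩
  · rintro g (hg | hg)
    · exact (hA.apart g hg).sup (((hA.spanned g hg).apart_edge h fun h' => hcA h'.2).sup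
        ((hA.spanned g hg).apart hB.rem_spanned hd))
    · exact ((hB.spanned g hg).apart hA.rem_spanned hd.symm).sup
        (((hB.spanned g hg).apart_edge h fun h' => hvB h'.1).sup (hB.apart g hg))
  · intro x hx
    rcases mem_union.1 hx with hx | hx
    · rcases hA.cover x hx with hx | ⟨g, hg, hx⟩
      exacts [.inl (by simp [hx]), .inr ⟨g, .inl hg, hx⟩]
    · rcases hB.cover x hx with hx | ⟨g, hg, hx⟩
      exacts [.inl (by simp [hx]), .inr ⟨g, .inr hg, hx⟩]
  · rcases hA.touch with h0 | ⟨g, hg, x, hx, hx'⟩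
    · rcases hB.touch with h0' | ⟨g, hg, x, hx, hx'⟩
      · exact .inl (by simp [h0, h0'])
      · exact .inr ⟨g, .inr hg, x, hx, .inr (.inr hx')⟩
    · exact .inr ⟨g, .inl hg, x, hx, .inl hx'⟩

end IsPartialGrouping

theorem RootedJoin.exists_isPartialGrouping [DecidableEq V] {w : V → ℕ} {p : ℕ} {A : Finset V}
    {v : V} (h : G.RootedJoin A v) (hp : 0 < p) (hw : ∀ v, w v ≤ p) :
    ∃ 𝒞 q, G.IsPartialGrouping w p p A v 𝒞 q := by
  induction h with
  | single v => exact (IsPartialGrouping.single hp (hw v)).exists_rem_lt hp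
  | join _ _ hAB h ihA ihB =>
    obtain ⟨_, _, hA⟩ := ihA
    obtain ⟨_, _, hB⟩ := ihB
    exact (hA.join hB hAB h).exists_rem_lt hp

/-- The remainder of a grouping can be absorbed by a group whose subgraph it meets. -/
theorem Connected.exists_grouping [Fintype V] [DecidableEq V] (hG : G.Connected) {w : V → ℕ}
    {p : ℕ} (hp : 0 < p) (hw : ∀ v, w v ≤ p) (htot : p ≤ ∑ v, w v) :
    ∃ 𝒞 : Set G.Group, (∀ g ∈ 𝒞, p ≤ ∑ x ∈ g.1, w x ∧ ∑ x ∈ g.1, w x ≤ 3 * p) ∧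
      (∀ g ∈ 𝒞, g.2.Connected ∧ ↑g.1 ⊆ g.2.verts) ∧ 𝒞.Pairwise Group.Apart ∧
      ∀ x, ∃ g ∈ 𝒞, x ∈ g.1 := by
  obtain ⟨r⟩ := hG.nonempty
  obtain ⟨𝒞, q, h⟩ := (hG.rootedJoin_univ r).exists_isPartialGrouping hp hw
  have hne : 𝒞 ≠ ∅ := by
    rintro rfl
    have hq : q.1 = Finset.univ := by simpa [eq_univ_iff_forall] using h.cover
    have := h.rem_weight
    rw [hq] at this
    omega
  obtain ⟨g₀, hg₀, hmeet⟩ := h.touch.resolve_left hne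
  refine ⟨Insert.insert (g₀.1 ∪ q.1, g₀.2 ⊔ q.2) (𝒞 \ {g₀}), ?_, ?_, ?_, ?_⟩
  · rintro g (rfl | hg)
    · have := h.weight g₀ hg₀
      have := h.rem_weight
      simp only [sum_union (h.apart g₀ hg₀).1]
      omega
    · have := h.weight g hg.1
      omega
  · rintro g (rfl | hg)
    · have := (h.spanned g₀ hg₀).sup h.rem_spanned hmeet
      exact ⟨this.connected, this.subset⟩
    · exact ⟨(h.spanned g hg.1).connected, (h.spanned g hg.1).subset⟩
  · exact Set.pairwise_insert_of_symm.2
      ⟨h.pairwise.mono Set.sdiff_subset, fun g hg _ =>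
        ((h.pairwise hg.1 hg₀ hg.2).sup (h.apart g hg.1)).symm⟩
  · intro x
    rcases h.cover x (mem_univ x) with hx | ⟨g, hg, hx⟩
    · exact ⟨_, .inl rfl, mem_union_right _ hx⟩
    · by_cases hgg : g = g₀
      · exact ⟨_, .inl rfl, mem_union_left _ (hgg ▸ hx)⟩
      · exact ⟨g, .inr ⟨hg, hgg⟩, hx⟩

end SimpleGraph

/-- Grouping theorem: a connected graph with vertex weights at most `p` and total weight at
least `p` admits a partition of its vertices into groups of weight between `p` and `3p`,
each spanned by a subtree, with the subtrees pairwise edge-disjoint. -/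
theorem stmt_0 {V : Type*} [Fintype V] [DecidableEq V] (G : SimpleGraph V)
    (hconn : G.Connected) (w : V → ℕ) (p : ℕ) (hp : 0 < p)
    (hw : ∀ v, w v ≤ p) (htot : p ≤ ∑ v, w v) :
    ∃ (𝒢 : Finpartition (Finset.univ : Finset V)) (T : Finset V → G.Subgraph),
      (∀ U ∈ 𝒢.parts, p ≤ ∑ v ∈ U, w v ∧ ∑ v ∈ U, w v ≤ 3 * p) ∧
      (∀ U ∈ 𝒢.parts, (T U).Connected ∧ (T U).coe.IsAcyclic ∧ ↑U ⊆ (T U).verts) ∧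
      (∀ U ∈ 𝒢.parts, ∀ U' ∈ 𝒢.parts, U ≠ U' →
        Disjoint (T U).edgeSet (T U').edgeSet) := by
  classical
  obtain ⟨𝒞, hwt, hspan, hpw, hcov⟩ := hconn.exists_grouping hp hw htot
  have htree : ∀ U : Finset V, ∃ T : G.Subgraph, ∀ H, (U, H) ∈ 𝒞 →
      ∃ H', (U, H') ∈ 𝒞 ∧ T ≤ H' ∧ T.Connected ∧ T.coe.IsAcyclic ∧ ↑U ⊆ T.verts := by
    intro U
    by_cases hU : ∃ H, (U, H) ∈ 𝒞
    · obtain ⟨H, hH⟩ := hU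
      obtain ⟨T, hle, hv, hT⟩ := (hspan _ hH).1.exists_isTree_le
      exact ⟨T, fun _ _ => ⟨H, hH, hle, hT.1, hT.2, hv ▸ (hspan _ hH).2⟩⟩
    · exact ⟨⊥, fun H hH => absurd ⟨H, hH⟩ hU⟩
  choose T hT using htree
  let parts : Finset (Finset V) := {U | ∃ H, (U, H) ∈ 𝒞}
  have hparts : ∀ {U}, U ∈ parts ↔ ∃ H, (U, H) ∈ 𝒞 := by simp [parts]
  have hdisj : (parts : Set (Finset V)).PairwiseDisjoint id := by
    intro U hU U' hU' hne
    obtain ⟨H, hH⟩ := hparts.1 hU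
    obtain ⟨H', hH'⟩ := hparts.1 hU'
    exact (hpw hH hH' fun h => hne (congrArg Prod.fst h)).1
  let 𝒢 : Finpartition (Finset.univ : Finset V) :=
    { parts := parts
      supIndep := supIndep_iff_pairwiseDisjoint.2 hdisj
      sup_parts := by
        refine eq_univ_iff_forall.2 fun x => ?_
        obtain ⟨g, hg, hx⟩ := hcov x
        exact mem_sup.2 ⟨g.1, hparts.2 ⟨g.2, hg⟩, hx⟩
      bot_notMem := by
        intro h
        obtain ⟨H, hH⟩ := hparts.1 h
        have := (hwt _ hH).1
        simp at this
        omega }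
  refine ⟨𝒢, T, ?_, ?_, ?_⟩
  · intro U hU
    obtain ⟨H, hH⟩ := hparts.1 hU
    exact hwt _ hH
  · intro U hU
    obtain ⟨H, hH⟩ := hparts.1 hU
    obtain ⟨_, -, -, h⟩ := hT U H hH
    exact h
  · intro U hU U' hU' hne
    obtain ⟨H, hH⟩ := hparts.1 hU
    obtain ⟨H', hH'⟩ := hparts.1 hU'
    obtain ⟨K, hK, hle, -⟩ := hT U H hH
    obtain ⟨K', hK', hle', -⟩ := hT U' H' hH'
    exact (hpw hK hK' fun h => hne (congrArg Prod.fst h)).2.mono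
      (SimpleGraph.Subgraph.edgeSet_mono hle) (SimpleGraph.Subgraph.edgeSet_mono hle')
end

section
/- Grouping composition lemma: Let Γ ⊆ out(S) be a set of boundary edges of S, grouped along a spanning tree T of G[S] ∪ out(S) into groups of size between p and 3p with edge-disjoint subtrees T(U) spanning each group U. Let Γ' contain one representative per group, and for each e ∈ Γ', let U'_e ⊆ U_e be a set of exactly p edges containing e. Suppose S is α-well-linked for Γ with 1/α ≤ p. Then for any two subsets X, Y ⊆ Γ' with |X| = |Y|, there exists a set of |X| paths in G[S] ∪ out(S), connecting the edges of X to the edges of Y in a one-to-one fashion, with total congestion at most 2. -/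
open Finset

/-- Edges of `G` with exactly one endpoint in `A`. -/
def outF {V : Type*} [Fintype V] [DecidableEq V] (G : SimpleGraph V)
    [DecidableRel G.Adj] (A : Finset V) : Finset (Sym2 V) :=
  G.edgeFinset.filter fun e => ∃ u v, e = s(u, v) ∧ u ∈ A ∧ v ∉ A

/-- Edges of `G` with one endpoint in `A` and the other in `B`. -/
def betweenF {V : Type*} [Fintype V] [DecidableEq V] (G : SimpleGraph V)
    [DecidableRel G.Adj] (A B : Finset V) : Finset (Sym2 V) :=
  G.edgeFinset.filter fun e => ∃ u v, e = s(u, v) ∧ u ∈ A ∧ v ∈ B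

section Flow

variable {N : Type*}

/-- The unit flow along a list of nodes, as a skew-symmetric function. -/
def pathFlow [DecidableEq N] : List N → N → N → ℤ
  | [], _, _ => 0
  | [_], _, _ => 0
  | a :: b :: l, u, v =>
    (if u = a ∧ v = b then 1 else 0) - (if v = a ∧ u = b then 1 else 0) + pathFlow (b :: l) u v

theorem pathFlow_skew [DecidableEq N] (l : List N) (u v : N) :
    pathFlow l u v = - pathFlow l v u := by
  induction l with
  | nil => simp [pathFlow]
  | cons a l ih =>
    cases l with
    | nil => simp [pathFlow]
    | cons b l => simp only [pathFlow]; rw [ih]; ring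

theorem sum_pathFlow [DecidableEq N] [Fintype N] {l : List N} {x y : N}
    (hx : l.head? = some x) (hy : l.getLast? = some y) (u : N) :
    ∑ v, pathFlow l u v = (if u = x then 1 else 0) - (if u = y then 1 else 0) := by
  induction l generalizing x with
  | nil => simp at hx
  | cons a l ih =>
    obtain rfl : a = x := by simpa using hx
    cases l with
    | nil =>
      obtain rfl : a = y := by simpa using hy
      simp [pathFlow]
    | cons b l =>
      have h := ih (x := b) (by simp) (by simpa using hy)
      simp only [pathFlow, Finset.sum_add_distrib, Finset.sum_sub_distrib, h]
      have h1 : ∑ v, (if u = a ∧ v = b then (1 : ℤ) else 0) = if u = a then 1 else 0 := by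
        by_cases hu : u = a <;> simp [hu]
      have h2 : ∑ v, (if v = a ∧ u = b then (1 : ℤ) else 0) = if u = b then 1 else 0 := by
        by_cases hu : u = b <;> simp [hu]
      rw [h1, h2]; ring

theorem mem_of_pair_infix {l : List N} {u v : N} (h : [u, v] <:+: l) : u ∈ l ∧ v ∈ l :=
  ⟨h.subset (by simp), h.subset (by simp)⟩

theorem pair_infix_cons_cons {a b u v : N} {l : List N} :
    [u, v] <:+: a :: b :: l ↔ (u = a ∧ v = b) ∨ [u, v] <:+: b :: l := by
  rw [List.infix_cons_iff]
  simp

theorem not_pair_infix_singleton {a u v : N} : ¬ [u, v] <:+: [a] := fun h => by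
  simpa using h.length_le

theorem pathFlow_of_nodup [DecidableEq N] {l : List N} (hl : l.Nodup) (u v : N) :
    pathFlow l u v = (if [u, v] <:+: l then 1 else 0) - (if [v, u] <:+: l then 1 else 0) := by
  induction l with
  | nil => simp [pathFlow]
  | cons a l ih =>
    cases l with
    | nil => simp [pathFlow, not_pair_infix_singleton]
    | cons b l =>
      have ha : a ∉ b :: l := (List.nodup_cons.1 hl).1
      have key : ∀ u v : N, (if [u, v] <:+: a :: b :: l then (1 : ℤ) else 0) =
          (if u = a ∧ v = b then 1 else 0) + (if [u, v] <:+: b :: l then 1 else 0) := by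
        intro u v
        rw [if_congr pair_infix_cons_cons rfl rfl]
        by_cases h : u = a ∧ v = b
        · have : ¬ [u, v] <:+: b :: l := fun h' => ha (h.1 ▸ (mem_of_pair_infix h').1)
          simp only [h.1, h.2] at this
          simp [h, this]
        · simp [h]
      rw [pathFlow, ih (List.nodup_cons.1 hl).2, key, key]
      ring

theorem rel_of_pair_infix {r : N → N → Prop} {l : List N} (hl : l.IsChain r) {u v : N}
    (h : [u, v] <:+: l) : r u v := by
  have := hl.infix h
  simpa using this

theorem exists_nodup_chain {r : N → N → Prop} {x y : N} (h : Relation.ReflTransGen r x y) :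
    ∃ l : List N, l.IsChain r ∧ l.Nodup ∧ l.head? = some x ∧ l.getLast? = some y := by
  induction h using Relation.ReflTransGen.head_induction_on with
  | refl => exact ⟨[y], by simp⟩
  | head hab _ ih =>
    rename_i a b _
    obtain ⟨l, hc, hn, hh, hlast⟩ := ih
    by_cases ha : a ∈ l
    · obtain ⟨l₁, l₂, rfl⟩ := List.append_of_mem ha
      refine ⟨a :: l₂, hc.suffix (List.suffix_append _ _),
        hn.sublist (List.sublist_append_right _ _),
        rfl, ?_⟩
      simpa [List.getLast?_append] using hlast
    · refine ⟨a :: l, ?_, List.nodup_cons.2 ⟨ha, hn⟩, rfl, ?_⟩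
      · cases l with
        | nil => simp at hh
        | cons c l =>
          obtain rfl : c = b := by simpa using hh
          exact List.isChain_cons_cons.2 ⟨hab, hc⟩
      · cases l with
        | nil => simp at hh
        | cons c l => simpa using hlast

theorem sum_net_eq_cut [Fintype N] [DecidableEq N] {f : N → N → ℤ}
    (hf : ∀ u v, f u v = - f v u) (R : Finset N) :
    ∑ u ∈ R, ∑ v, f u v = ∑ u ∈ R, ∑ v ∈ Rᶜ, f u v := by
  have h0 : ∑ u ∈ R, ∑ v ∈ R, f u v = 0 := by
    have h1 : ∑ u ∈ R, ∑ v ∈ R, f u v = - ∑ u ∈ R, ∑ v ∈ R, f u v := by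
      conv_lhs => rw [Finset.sum_comm]
      simp only [← Finset.sum_neg_distrib]
      exact Finset.sum_congr rfl fun u _ => Finset.sum_congr rfl fun v _ => hf v u
    omega
  rw [← zero_add (∑ u ∈ R, ∑ v ∈ Rᶜ, f u v), ← h0, ← Finset.sum_add_distrib]
  exact Finset.sum_congr rfl fun u _ => (Finset.sum_add_sum_compl R _).symm

/-- Integral flow with prescribed net outflow: the cut condition suffices. -/
theorem exists_flow_of_cut [Fintype N] [DecidableEq N] (c : N → N → ℤ) (hc : ∀ u v, 0 ≤ c u v)
    (b : N → ℤ) (hb : ∑ u, b u = 0)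
    (hcut : ∀ W : Finset N, ∑ u ∈ W, b u ≤ ∑ u ∈ W, ∑ v ∈ Wᶜ, c u v) :
    ∃ f : N → N → ℤ, (∀ u v, f u v = - f v u) ∧ (∀ u v, f u v ≤ c u v) ∧
      ∀ u, ∑ v, f u v = b u := by
  classical
  let feas : Set (N → N → ℤ) := {f | (∀ u v, f u v = - f v u) ∧ ∀ u v, f u v ≤ c u v}
  let d : (N → N → ℤ) → ℕ := fun f => ∑ u, (b u - ∑ v, f u v).natAbs
  have hne : feas.Nonempty := ⟨fun _ _ => 0, by simp, by simpa using hc⟩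
  obtain ⟨f, ⟨hskew, hle⟩, hmin⟩ :=
    WellFounded.has_min (InvImage.wf d Nat.lt_wfRel.wf) feas hne
  refine ⟨f, hskew, hle, ?_⟩
  by_contra! hbad
  have hsum : ∑ u, (b u - ∑ v, f u v) = 0 := by
    have := sum_net_eq_cut hskew Finset.univ
    rw [Finset.sum_sub_distrib, hb, this]
    simp
  obtain ⟨x, hx⟩ : ∃ x, 0 < b x - ∑ v, f x v := by
    by_contra! hx
    obtain ⟨u, hu⟩ := hbad
    have := (Finset.sum_eq_zero_iff_of_nonpos fun u _ => hx u).1 hsum u (Finset.mem_univ u)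
    omega
  let r : N → N → Prop := fun u v => f u v < c u v
  let R : Finset N := Finset.univ.filter (Relation.ReflTransGen r x)
  have hxR : x ∈ R := by simp [R, Relation.ReflTransGen.refl]
  obtain ⟨y, hyR, hy⟩ : ∃ y ∈ R, b y - ∑ v, f y v < 0 := by
    by_contra! hy
    have h1 : 0 < ∑ u ∈ R, (b u - ∑ v, f u v) := Finset.sum_pos' hy ⟨x, hxR, hx⟩
    rw [Finset.sum_sub_distrib, sum_net_eq_cut hskew R] at h1
    have h2 : ∑ u ∈ R, ∑ v ∈ Rᶜ, f u v = ∑ u ∈ R, ∑ v ∈ Rᶜ, c u v := by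
      refine Finset.sum_congr rfl fun u hu => Finset.sum_congr rfl fun v hv => ?_
      refine le_antisymm (hle u v) (not_lt.1 fun h => ?_)
      simp only [R, Finset.mem_compl, Finset.mem_filter, Finset.mem_univ, true_and] at hu hv
      exact hv (hu.tail h)
    have := hcut R
    omega
  obtain ⟨l, hlc, hln, hlx, hly⟩ := exists_nodup_chain (r := r) (x := x) (y := y)
    (by simpa [R] using hyR)
  have hxy : x ≠ y := by rintro rfl; omega
  refine hmin (fun u v => f u v + pathFlow l u v) ⟨fun u v => ?_, fun u v => ?_⟩ ?_
  · change f u v + pathFlow l u v = -(f v u + pathFlow l v u)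
    rw [hskew u v, pathFlow_skew l u v]; ring
  · simp only [pathFlow_of_nodup hln]
    have := hle u v
    by_cases h : [u, v] <:+: l
    · have : f u v < c u v := rel_of_pair_infix hlc h
      split_ifs <;> omega
    · split_ifs <;> omega
  · change d _ < d _
    refine Finset.sum_lt_sum (fun u _ => ?_) ⟨x, Finset.mem_univ x, ?_⟩
    · simp only [Finset.sum_add_distrib, sum_pathFlow hlx hly]
      by_cases h1 : u = x
      · subst h1; simp only [if_true, if_neg hxy]; omega
      · by_cases h2 : u = y
        · subst h2; simp only [if_true, if_neg h1]; omega
        · simp [h1, h2]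
    · simp only [Finset.sum_add_distrib, sum_pathFlow hlx hly, if_true, if_neg hxy]
      omega

/-- Decomposition of an integral flow with unit sources `A` and unit sinks `B` into paths. -/
theorem exists_paths_of_flow [Fintype N] [DecidableEq N] (A B : Finset N) (hAB : Disjoint A B)
    (f : N → N → ℤ) (hf : ∀ u v, f u v = - f v u)
    (hnet : ∀ u, ∑ v, f u v = (if u ∈ A then 1 else 0) - (if u ∈ B then 1 else 0)) :
    ∃ (g : N → N) (P : N → List N), Set.InjOn g A ∧
      (∀ x ∈ A, g x ∈ B ∧ (P x).IsChain (fun u v => 0 < f u v) ∧ (P x).Nodup ∧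
        (P x).head? = some x ∧ (P x).getLast? = some (g x)) ∧
      ∀ u v, ((A.filter fun x => [u, v] <:+: P x).card : ℤ) ≤ max (f u v) 0 := by
  classical
  induction hn : A.card generalizing A B f with
  | zero =>
    obtain rfl := Finset.card_eq_zero.1 hn
    exact ⟨id, fun _ => [], by simp, by simp, by simp⟩
  | succ n ih =>
    obtain ⟨x, hx⟩ := Finset.card_pos.1 (by omega : 0 < A.card)
    let r : N → N → Prop := fun u v => 0 < f u v
    let R : Finset N := Finset.univ.filter (Relation.ReflTransGen r x)
    have hxR : x ∈ R := by simp [R, Relation.ReflTransGen.refl]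
    obtain ⟨y, hyR, hy⟩ : ∃ y ∈ R, y ∈ B := by
      by_contra! hno
      have h1 : ∑ u ∈ R, ∑ v, f u v ≤ 0 := by
        rw [sum_net_eq_cut hf R]
        refine Finset.sum_nonpos fun u hu => Finset.sum_nonpos fun v hv => not_lt.1 fun h => ?_
        simp only [R, Finset.mem_compl, Finset.mem_filter, Finset.mem_univ, true_and] at hu hv
        exact hv (hu.tail h)
      have h2 : 0 < ∑ u ∈ R, ∑ v, f u v := by
        refine Finset.sum_pos' (fun u hu => ?_) ⟨x, hxR, ?_⟩
        · rw [hnet, if_neg (hno u hu)]; split_ifs <;> simp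
        · rw [hnet, if_neg (hno x hxR), if_pos hx]; simp
      omega
    obtain ⟨l, hlc, hln, hlx, hly⟩ := exists_nodup_chain (r := r) (x := x) (y := y)
      (by simpa [R] using hyR)
    have hxy : x ≠ y := fun h => Finset.disjoint_left.1 hAB hx (h ▸ hy)
    have hcap : ∀ u v, max (f u v - pathFlow l u v) 0 + (if [u, v] <:+: l then 1 else 0) ≤
        max (f u v) 0 := by
      intro u v
      rw [pathFlow_of_nodup hln]
      have := hf u v
      have h1 : [u, v] <:+: l → 0 < f u v := fun h => rel_of_pair_infix hlc h
      have h2 : [v, u] <:+: l → 0 < f v u := fun h => rel_of_pair_infix hlc h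
      split_ifs with h3 h4 h4
      · have := h1 h3; have := h2 h4; omega
      · have := h1 h3; omega
      · have := h2 h4; omega
      · omega
    obtain ⟨g, P, hg, hP, hcount⟩ := ih (A.erase x) (B.erase y)
      (hAB.mono (Finset.erase_subset _ _) (Finset.erase_subset _ _))
      (fun u v => f u v - pathFlow l u v)
      (fun u v => by rw [hf u v, pathFlow_skew l u v]; ring)
      (fun u => by
        simp only [Finset.sum_sub_distrib, sum_pathFlow hlx hly, hnet, Finset.mem_erase]
        by_cases h1 : u = x
        · subst h1; simp [hx, hxy]
        · by_cases h2 : u = y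
          · subst h2; simp [hy, h1]
          · simp [h1, h2])
      (by rw [Finset.card_erase_of_mem hx]; omega)
    refine ⟨Function.update g x y, Function.update P x l, ?_, ?_, ?_⟩
    · rintro a ha a' ha' h
      by_cases h1 : a = x <;> by_cases h2 : a' = x
      · rw [h1, h2]
      · subst h1
        rw [Function.update_self, Function.update_of_ne h2] at h
        have := (hP a' (Finset.mem_erase.2 ⟨h2, ha'⟩)).1
        simp [← h] at this
      · subst h2
        rw [Function.update_self, Function.update_of_ne h1] at h
        have := (hP a (Finset.mem_erase.2 ⟨h1, ha⟩)).1
        simp [h] at this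
      · rw [Function.update_of_ne h2, Function.update_of_ne h1] at h
        exact hg (by simp [h1]; exact ha) (by simp [h2]; exact ha') h
    · intro a ha
      by_cases h1 : a = x
      · subst h1
        simp only [Function.update_self]
        exact ⟨hy, hlc, hln, hlx, hly⟩
      · simp only [Function.update_of_ne h1]
        obtain ⟨h2, h3, h4⟩ := hP a (Finset.mem_erase.2 ⟨h1, ha⟩)
        refine ⟨Finset.mem_of_mem_erase h2, h3.imp fun u v huv => ?_, h4⟩
        have := hcap u v
        split_ifs at this <;> omega
    · intro u v
      refine le_trans ?_ (hcap u v)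
      have h1 : A.filter (fun a => [u, v] <:+: Function.update P x l a) ⊆
          ((A.erase x).filter fun a => [u, v] <:+: P a) ∪
            (if [u, v] <:+: l then {x} else ∅) := by
        intro a ha
        rw [Finset.mem_filter] at ha
        by_cases h : a = x
        · subst h
          rw [Function.update_self] at ha
          simp [ha.2]
        · rw [Function.update_of_ne h] at ha
          simp [h, ha]
      have h2 := (Finset.card_le_card h1).trans (Finset.card_union_le _ _)
      have h3 := hcount u v
      split_ifs at h2 ⊢ <;> simp at h2 <;> omega

end Flow

/-- The edges of `H` crossing the boundary of `A`. -/
noncomputable def crossing {V : Type*} (H : Finset (Sym2 V)) (A : Finset V) : Finset (Sym2 V) :=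
  open scoped Classical in H.filter fun e => ∃ u v, e = s(u, v) ∧ u ∈ A ∧ v ∉ A

theorem mem_crossing {V : Type*} {H : Finset (Sym2 V)} {A : Finset V} {e : Sym2 V} :
    e ∈ crossing H A ↔ e ∈ H ∧ ∃ u v, e = s(u, v) ∧ u ∈ A ∧ v ∉ A := by
  simp [crossing]

section EdgeTerminals

variable {V : Type*} [DecidableEq V]

/-- Edges in `H` have capacity two; an edge of `X` (resp. `Y`) is a source (resp. sink) node
joined to its endpoints. -/
def terminalCap (H X Y : Finset (Sym2 V)) : V ⊕ Sym2 V → V ⊕ Sym2 V → ℤ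
  | .inl u, .inl v => if s(u, v) ∈ H then 2 else 0
  | .inr e, .inl v => if e ∈ X ∧ v ∈ e then 1 else 0
  | .inl v, .inr e => if e ∈ Y ∧ v ∈ e then 1 else 0
  | .inr _, .inr _ => 0

theorem two_mul_card_crossing_le [Fintype V] (H : Finset (Sym2 V)) (A : Finset V) :
    2 * ((crossing H A).card : ℤ) ≤
      ∑ u : V, ∑ v : V, if u ∈ A ∧ v ∉ A then (if s(u, v) ∈ H then 2 else 0) else 0 := by
  classical
  let D : Finset (V × V) := univ.filter fun q => (q.1 ∈ A ∧ q.2 ∉ A) ∧ s(q.1, q.2) ∈ H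
  have h1 : crossing H A ⊆ D.image fun q => s(q.1, q.2) := by
    intro e he
    obtain ⟨heH, u, v, rfl, hu, hv⟩ := mem_crossing.1 he
    exact mem_image.2 ⟨(u, v), by simp [D, hu, hv, heH], rfl⟩
  have h2 : (crossing H A).card ≤ D.card := (card_le_card h1).trans card_image_le
  rw [← Fintype.sum_prod_type'
    (f := fun u v => if u ∈ A ∧ v ∉ A then (if s(u, v) ∈ H then (2 : ℤ) else 0) else 0)]
  have h3 : ∑ q : V × V,
      (if q.1 ∈ A ∧ q.2 ∉ A then (if s(q.1, q.2) ∈ H then (2 : ℤ) else 0) else 0)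
      = 2 * D.card := by
    simp only [← ite_and]
    rw [← sum_filter, sum_const, nsmul_eq_mul, mul_comm]
  rw [h3]
  exact_mod_cast Nat.mul_le_mul_left 2 h2

theorem exists_terminal_flow [Fintype V] (H X Y : Finset (Sym2 V)) (hcard : X.card = Y.card)
    (hcut : ∀ A : Finset V, (X.filter fun e => ∀ v ∈ e, v ∈ A).card +
      (Y.filter fun e => ∀ v ∈ e, v ∉ A).card ≤ X.card + 2 * (crossing H A).card) :
    ∃ f : V ⊕ Sym2 V → V ⊕ Sym2 V → ℤ, (∀ u v, f u v = - f v u) ∧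
      (∀ u v, f u v ≤ terminalCap H X Y u v) ∧
      ∀ u, ∑ v, f u v = (if u ∈ X.image Sum.inr then 1 else 0) -
        (if u ∈ Y.image Sum.inr then 1 else 0) := by
  classical
  have hnonneg : ∀ u v, 0 ≤ terminalCap H X Y u v := by
    rintro (u | e) (v | e') <;> simp only [terminalCap] <;> (try split_ifs) <;> norm_num
  refine exists_flow_of_cut (terminalCap H X Y) hnonneg _ ?_ fun W => ?_
  · simp only [sum_sub_distrib, sum_ite_mem, univ_inter, sum_const,
      card_image_of_injective _ Sum.inr_injective, hcard, sub_self]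
  · let A : Finset V := univ.filter fun v => Sum.inl v ∈ W
    let XW := X.filter fun e => Sum.inr e ∈ W
    let YW := Y.filter fun e => Sum.inr e ∈ W
    let YN := Y.filter fun e => Sum.inr e ∉ W
    let X1 := X.filter fun e => ∀ v ∈ e, v ∈ A
    let Y1 := Y.filter fun e => ∀ v ∈ e, v ∉ A
    have hlhs : ∑ u ∈ W, ((if u ∈ X.image Sum.inr then (1 : ℤ) else 0) -
        (if u ∈ Y.image Sum.inr then 1 else 0)) = XW.card - YW.card := by
      have key : ∀ Z : Finset (Sym2 V), ∑ u ∈ W, (if u ∈ Z.image Sum.inr then (1 : ℤ) else 0) =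
          (Z.filter fun e => Sum.inr e ∈ W).card := by
        intro Z
        have hW : W.filter (· ∈ Z.image Sum.inr) =
            (Z.filter fun e => Sum.inr e ∈ W).image Sum.inr := by
          ext u
          simp only [mem_filter, mem_image]
          constructor
          · rintro ⟨hu, e, he, rfl⟩; exact ⟨e, ⟨he, hu⟩, rfl⟩
          · rintro ⟨e, ⟨he, hu⟩, rfl⟩; exact ⟨hu, e, he, rfl⟩
        rw [← sum_filter, sum_const, nsmul_eq_mul, mul_one, hW,
          card_image_of_injective _ Sum.inr_injective]
      rw [sum_sub_distrib, key, key]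
    have hrhs : ∑ u ∈ W, ∑ v ∈ Wᶜ, terminalCap H X Y u v =
        ∑ u, ∑ v, if u ∈ W ∧ v ∉ W then terminalCap H X Y u v else 0 := by
      rw [← univ_inter W, ← sum_ite_mem, univ_inter]
      refine sum_congr rfl fun u _ => ?_
      by_cases h : u ∈ W
      · simp only [h, true_and, if_true, ← mem_compl, sum_ite_mem, univ_inter]
      · simp [h]
    have hnn : ∀ u v, 0 ≤ if u ∈ W ∧ v ∉ W then terminalCap H X Y u v else 0 := by
      intro u v
      split_ifs
      exacts [hnonneg u v, le_rfl]
    have hcount : ∀ (Z : Finset (Sym2 V)) (F : Sym2 V → ℤ), (∀ e, 0 ≤ F e) →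
        (∀ e ∈ Z, 1 ≤ F e) → (Z.card : ℤ) ≤ ∑ e, F e := by
      intro Z F h0 h1
      refine le_trans ?_ (sum_le_univ_sum_of_nonneg (s := Z) h0)
      simpa using card_nsmul_le_sum Z F 1 h1
    rw [hlhs, hrhs]
    simp only [Fintype.sum_sum_type, sum_add_distrib]
    have hVV : 2 * ((crossing H A).card : ℤ) ≤ ∑ u : V, ∑ v : V,
        if Sum.inl u ∈ W ∧ Sum.inl v ∉ W then terminalCap H X Y (.inl u) (.inl v) else 0 := by
      simpa [A, terminalCap] using two_mul_card_crossing_le H A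
    have hEV : ((XW \ X1).card : ℤ) ≤ ∑ e : Sym2 V, ∑ v : V,
        if Sum.inr e ∈ W ∧ Sum.inl v ∉ W then terminalCap H X Y (.inr e) (.inl v) else 0 := by
      refine hcount _ _ (fun e => sum_nonneg fun v _ => hnn _ _) fun e he => ?_
      simp only [XW, X1, A, mem_sdiff, mem_filter, mem_univ, true_and, not_and, not_forall] at he
      obtain ⟨⟨heX, heW⟩, he⟩ := he
      obtain ⟨v, hve, hv⟩ := he heX
      refine le_trans ?_ (single_le_sum (fun v _ => hnn _ _) (mem_univ v))
      simp [terminalCap, heX, heW, hve, hv]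
    have hVE : ((YN \ Y1).card : ℤ) ≤ ∑ v : V, ∑ e : Sym2 V,
        if Sum.inl v ∈ W ∧ Sum.inr e ∉ W then terminalCap H X Y (.inl v) (.inr e) else 0 := by
      rw [sum_comm]
      refine hcount _ _ (fun e => sum_nonneg fun v _ => hnn _ _) fun e he => ?_
      simp only [YN, Y1, A, mem_sdiff, mem_filter, mem_univ, true_and, not_and, not_forall,
        not_not] at he
      obtain ⟨⟨heY, heW⟩, he⟩ := he
      obtain ⟨v, hve, hv⟩ := he heY
      refine le_trans ?_ (single_le_sum (fun v _ => hnn _ _) (mem_univ v))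
      simp [terminalCap, heY, heW, hve, hv]
    have hEE : 0 ≤ ∑ e : Sym2 V, ∑ e' : Sym2 V,
        if Sum.inr e ∈ W ∧ Sum.inr e' ∉ W then terminalCap H X Y (.inr e) (.inr e') else 0 := by
      simp [terminalCap]
    have h1 : X1.card + Y1.card ≤ X.card + 2 * (crossing H A).card := hcut A
    have h2 : XW.card ≤ (XW \ X1).card + X1.card := card_le_card_sdiff_add_card
    have h3 : YN.card ≤ (YN \ Y1).card + Y1.card := card_le_card_sdiff_add_card
    have h4 : YW.card + YN.card = Y.card := card_filter_add_card_filter_not _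
    omega

theorem exists_walk_of_chain {G : SimpleGraph V} {H X Y : Finset (Sym2 V)}
    (hH : ↑H ⊆ G.edgeSet) (hY : ↑Y ⊆ G.edgeSet) (hXY : Disjoint X Y) {e' : Sym2 V}
    (l : List (V ⊕ Sym2 V)) (a : V)
    (hc : (Sum.inl a :: l).IsChain fun u v => 0 < terminalCap H X Y u v)
    (hn : (Sum.inl a :: l).Nodup) (hl : (Sum.inl a :: l).getLast? = some (.inr e')) :
    ∃ (w : V) (q : G.Walk a w) (es : List (Sym2 V)), q.edges = es ++ [e'] ∧ es.Nodup ∧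
      ∀ f ∈ es, f ∈ H ∧ ∃ u v, f = s(u, v) ∧ [Sum.inl u, Sum.inl v] <:+: Sum.inl a :: l := by
  induction l generalizing a with
  | nil => simp at hl
  | cons b l ih =>
    obtain ⟨hab, hc'⟩ := List.isChain_cons_cons.1 hc
    obtain ⟨ha, hn'⟩ := List.nodup_cons.1 hn
    have hl' : (b :: l).getLast? = some (.inr e') := by simpa using hl
    cases b with
    | inl b =>
      have habH : s(a, b) ∈ H := by
        by_contra h
        simp [terminalCap, h] at hab
      obtain ⟨w, q, es, hq, hes, hf⟩ := ih b hc' hn' hl'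
      refine ⟨w, .cons (G.mem_edgeSet.1 (hH habH)) q, s(a, b) :: es, by simp [hq], ?_, ?_⟩
      · refine List.nodup_cons.2 ⟨fun h => ?_, hes⟩
        obtain ⟨-, u, v, huv, hi⟩ := hf _ h
        obtain ⟨hu, hv⟩ := mem_of_pair_infix hi
        rcases Sym2.eq_iff.1 huv with ⟨rfl, rfl⟩ | ⟨rfl, rfl⟩
        · exact ha hu
        · exact ha hv
      · intro f hfm
        rcases List.mem_cons.1 hfm with rfl | hfm
        · exact ⟨habH, a, b, rfl, pair_infix_cons_cons.2 (.inl ⟨rfl, rfl⟩)⟩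
        · obtain ⟨h1, u, v, h2, h3⟩ := hf f hfm
          exact ⟨h1, u, v, h2, pair_infix_cons_cons.2 (.inr h3)⟩
    | inr e =>
      have hae : e ∈ Y ∧ a ∈ e := by
        by_contra h
        simp [terminalCap, h] at hab
      have hle : l = [] := by
        cases l with
        | nil => rfl
        | cons d l =>
          have hed := (List.isChain_cons_cons.1 hc').1
          have heX : e ∉ X := fun h => disjoint_left.1 hXY h hae.1
          cases d <;> simp [terminalCap, heX] at hed
      subst hle
      obtain rfl : e = e' := by simpa using hl'
      obtain ⟨o, rfl⟩ := hae.2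
      exact ⟨o, .cons (G.mem_edgeSet.1 (hY hae.1)) .nil, [], by simp⟩

/-- Edge-Menger with capacity two: the cut condition yields trails joining the edges of `X`
to the edges of `Y` through `H`. -/
theorem exists_trails_of_cut [Fintype V] {G : SimpleGraph V} {H X Y : Finset (Sym2 V)}
    (hH : ↑H ⊆ G.edgeSet) (hX : ↑X ⊆ G.edgeSet) (hY : ↑Y ⊆ G.edgeSet) (hXY : Disjoint X Y)
    (hcard : X.card = Y.card)
    (hcut : ∀ A : Finset V, (X.filter fun e => ∀ v ∈ e, v ∈ A).card +
      (Y.filter fun e => ∀ v ∈ e, v ∉ A).card ≤ X.card + 2 * (crossing H A).card) :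
    ∃ (g : Sym2 V → Sym2 V) (es : Sym2 V → List (Sym2 V)), Set.InjOn g X ∧
      (∀ e ∈ X, g e ∈ Y ∧ (es e).Nodup ∧ (∀ f ∈ es e, f ∈ H) ∧
        ∃ (u v : V) (q : G.Walk u v), q.edges = e :: (es e ++ [g e])) ∧
      ∀ f, (X.filter fun e => f ∈ es e).card ≤ 2 := by
  classical
  obtain ⟨f, hskew, hle, hnet⟩ := exists_terminal_flow H X Y hcard hcut
  obtain ⟨g, P, hg, hP, hcount⟩ := exists_paths_of_flow (X.image Sum.inr) (Y.image Sum.inr)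
    ((disjoint_image Sum.inr_injective).2 hXY) f hskew hnet
  have key : ∀ e ∈ X, ∃ (e' : Sym2 V) (es : List (Sym2 V)), g (.inr e) = .inr e' ∧ e' ∈ Y ∧
      es.Nodup ∧ (∀ f ∈ es, f ∈ H ∧ ∃ u v, f = s(u, v) ∧ [Sum.inl u, Sum.inl v] <:+: P (.inr e)) ∧
        ∃ (u v : V) (q : G.Walk u v), q.edges = e :: (es ++ [e']) := by
    intro e he
    obtain ⟨h1, h2, h3, h4, h5⟩ := hP (.inr e) (mem_image_of_mem _ he)
    obtain ⟨e', he', hge⟩ := mem_image.1 h1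
    have h2' := h2.imp fun u v huv => lt_of_lt_of_le huv (hle u v)
    rw [← hge] at h5
    cases hl : P (.inr e) with
    | nil => simp [hl] at h4
    | cons x l =>
      rw [hl] at h2' h3 h4 h5
      obtain rfl : x = .inr e := by simpa using h4
      cases l with
      | nil =>
        obtain rfl : e = e' := by simpa using h5
        exact absurd he' (disjoint_left.1 hXY he)
      | cons b l =>
        obtain ⟨heb, hc⟩ := List.isChain_cons_cons.1 h2'
        cases b with
        | inr d => simp [terminalCap] at heb
        | inl a =>
          have hae : a ∈ e := by
            by_contra h
            simp [terminalCap, h] at heb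
          obtain ⟨w, q, es, hq, hn, hes⟩ := exists_walk_of_chain hH hY hXY l a hc
            (List.nodup_cons.1 h3).2 (by simpa using h5)
          obtain ⟨o, rfl⟩ := hae
          refine ⟨e', es, hge.symm, he', hn, fun f hf => ?_,
            o, w, .cons (G.mem_edgeSet.1 (hX he)).symm q, ?_⟩
          · obtain ⟨hfH, u, v, huv, hi⟩ := hes f hf
            exact ⟨hfH, u, v, huv, pair_infix_cons_cons.2 (.inr hi)⟩
          · simp [hq, Sym2.eq_swap]
  choose! g' es hgg hgY hn hes hw using key
  refine ⟨g', es, fun e he d hd h => ?_,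
    fun e he => ⟨hgY e he, hn e he, fun f hf => (hes e he f hf).1, hw e he⟩, fun f' => ?_⟩
  · have := hg (mem_image_of_mem _ he) (mem_image_of_mem _ hd)
      ((hgg e he).trans ((congrArg Sum.inr h).trans (hgg d hd).symm))
    exact Sum.inr_injective this
  · induction f' using Sym2.ind with | _ u v
    let A : V → V → Finset (V ⊕ Sym2 V) := fun u v =>
      (X.image Sum.inr).filter fun x => [Sum.inl u, Sum.inl v] <:+: P x
    have h1 : (X.filter fun e => s(u, v) ∈ es e).image Sum.inr ⊆ A u v ∪ A v u := by
      intro x hx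
      obtain ⟨e, he, rfl⟩ := mem_image.1 hx
      obtain ⟨heX, hm⟩ := mem_filter.1 he
      obtain ⟨-, u', v', huv, hi⟩ := hes e heX _ hm
      have heX' : (Sum.inr e : V ⊕ Sym2 V) ∈ X.image Sum.inr := mem_image_of_mem _ heX
      rcases Sym2.eq_iff.1 huv with ⟨rfl, rfl⟩ | ⟨rfl, rfl⟩
      · exact mem_union_left _ (mem_filter.2 ⟨heX', hi⟩)
      · exact mem_union_right _ (mem_filter.2 ⟨heX', hi⟩)
    have h2 := (card_le_card h1).trans (card_union_le _ _)
    rw [card_image_of_injective _ Sum.inr_injective] at h2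
    have h3 := hcount (.inl u) (.inl v)
    have h4 := hcount (.inl v) (.inl u)
    have h5 : ∀ u v : V, f (.inl u) (.inl v) ≤ 2 := fun u v =>
      (hle _ _).trans (by simp only [terminalCap]; split_ifs <;> norm_num)
    have h6 := hskew (.inl u) (.inl v)
    have h7 := h5 u v
    have h8 := h5 v u
    simp only [A] at h2
    omega

end EdgeTerminals

theorem SimpleGraph.Subgraph.Connected.verts_subset_of_no_crossing {V : Type*}
    {G : SimpleGraph V} {t : G.Subgraph} (ht : t.Connected) {A : Set V} {a : V} (hat : a ∈ t.verts)
    (ha : a ∈ A) (hcross : ∀ u v, t.Adj u v → u ∈ A → v ∈ A) : t.verts ⊆ A := by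
  intro b hb
  obtain ⟨q⟩ := ht.coe.preconnected ⟨a, hat⟩ ⟨b, hb⟩
  by_contra hbA
  obtain ⟨d, -, h1, h2⟩ := q.exists_boundary_dart (Subtype.val ⁻¹' A) ha hbA
  exact h2 (hcross _ _ d.adj h1)

/-- Grouping composition lemma: let `Γ ⊆ out(S)` be grouped into groups of size between
`p` and `3p` with pairwise edge-disjoint connected subtrees of `G[S] ∪ out(S)` spanning
them, let `Γ'` consist of one representative per group and, for each representative, fix
a subset `U'_e` of exactly `p` group edges containing it.  If `S` is `α`-well-linked for
`Γ` with `1/α ≤ p`, then any two equal-sized subsets `X, Y ⊆ Γ'` can be connected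
one-to-one by trails in `G[S] ∪ out(S)` — each trail starting with its `X`-edge and
ending with the matched `Y`-edge — with total congestion at most `2`. -/
theorem stmt_19 {V : Type*} [Fintype V] [DecidableEq V] (G : SimpleGraph V)
    [DecidableRel G.Adj] (S : Finset V) (Γ : Finset (Sym2 V)) (p : ℕ) (α : ℝ)
    (hΓ : Γ ⊆ outF G S) (hp : 1 ≤ p) (hα : 0 < α) (hαp : 1 / α ≤ (p : ℝ))
    (𝒢 : Finset (Finset (Sym2 V)))
    (hcover : 𝒢.sup id = Γ)
    (hgdisj : ∀ U ∈ 𝒢, ∀ U' ∈ 𝒢, U ≠ U' → Disjoint U U')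
    (hsize : ∀ U ∈ 𝒢, p ≤ U.card ∧ U.card ≤ 3 * p)
    (t : Finset (Sym2 V) → G.Subgraph)
    (htree : ∀ U ∈ 𝒢, (t U).Connected ∧ ↑U ⊆ (t U).edgeSet ∧
      ∀ f ∈ (t U).edgeSet, ∃ x ∈ S, x ∈ f)
    (htdisj : ∀ U ∈ 𝒢, ∀ U' ∈ 𝒢, U ≠ U' → Disjoint (t U).edgeSet (t U').edgeSet)
    (rep : Finset (Sym2 V) → Sym2 V) (hrep : ∀ U ∈ 𝒢, rep U ∈ U)
    (U' : Finset (Sym2 V) → Finset (Sym2 V))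
    (hU' : ∀ U ∈ 𝒢, U' U ⊆ U ∧ (U' U).card = p ∧ rep U ∈ U' U)
    (hwl : ∀ X Y : Finset V, Disjoint X Y → X ∪ Y = S →
      α * min ((Γ ∩ outF G X).card : ℝ) ((Γ ∩ outF G Y).card : ℝ) ≤
        ((betweenF G X Y).card : ℝ)) :
    ∀ X Y : Finset (Sym2 V), X ⊆ 𝒢.image rep → Y ⊆ 𝒢.image rep → X.card = Y.card →
      ∃ g : Sym2 V → Sym2 V, Set.InjOn g ↑X ∧ X.image g = Y ∧
        ∃ P : Sym2 V → Σ (u : V) (v : V), G.Walk u v,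
          (∀ e ∈ X, (P e).2.2.edges.head? = some e ∧
            (P e).2.2.edges.getLast? = some (g e) ∧
            (P e).2.2.edges.Nodup ∧
            ∀ f ∈ (P e).2.2.edges, ∃ x ∈ S, x ∈ f) ∧
          (∀ f : Sym2 V, (X.filter fun e => f ∈ (P e).2.2.edges).card ≤ 2) := by
  classical
  have hmemΓ : ∀ U ∈ 𝒢, U ⊆ Γ := fun U hU => hcover ▸ le_sup (f := id) hU
  have hΓS : ∀ e ∈ Γ, ∃ u v, e = s(u, v) ∧ u ∈ S ∧ v ∉ S := fun e he =>
    (mem_filter.1 (hΓ he)).2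
  have hΓG : ∀ e ∈ Γ, e ∈ G.edgeSet := fun e he =>
    SimpleGraph.mem_edgeFinset.1 (mem_filter.1 (hΓ he)).1
  intro X Y hX hY hXYcard
  have hgrp : ∀ e ∈ X ∪ Y, ∃ U ∈ 𝒢, rep U = e := fun e he =>
    mem_image.1 (union_subset hX hY he)
  choose! grp hgrp𝒢 hgrprep using hgrp
  have hXYΓ : X ∪ Y ⊆ Γ := fun e he => by
    rw [← hgrprep e he]
    exact hmemΓ _ (hgrp𝒢 e he) (hrep _ (hgrp𝒢 e he))
  have hgrpinj : ∀ e ∈ X ∪ Y, ∀ d ∈ X ∪ Y, ∀ f, f ∈ (t (grp e)).edgeSet →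
      f ∈ (t (grp d)).edgeSet → e = d := by
    intro e he d hd f hfe hfd
    by_contra hne
    have h : grp e ≠ grp d := fun h => hne (by rw [← hgrprep e he, ← hgrprep d hd, h])
    exact Set.disjoint_left.1 (htdisj _ (hgrp𝒢 e he) _ (hgrp𝒢 d hd) h) hfe hfd
  have hself : ∀ e ∈ X ∪ Y, e ∈ (t (grp e)).edgeSet := fun e he => by
    have := (htree _ (hgrp𝒢 e he)).2.1 (hrep _ (hgrp𝒢 e he))
    rwa [hgrprep e he] at this
  let H : Finset (Sym2 V) := G.edgeFinset.filter fun f => (∃ x ∈ S, x ∈ f) ∧ f ∉ X ∪ Y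
  have hHG : ∀ f ∈ H, f ∈ G.edgeSet := fun f hf => SimpleGraph.mem_edgeFinset.1 (mem_filter.1 hf).1
  have hXG : ∀ e ∈ X ∪ Y, e ∈ G.edgeSet := fun e he => hΓG e (hXYΓ he)
  have hcard : (X \ Y).card = (Y \ X).card := card_sdiff_comm hXYcard
  have hcut : ∀ A : Finset V, ((X \ Y).filter fun e => ∀ v ∈ e, v ∈ A).card +
      ((Y \ X).filter fun e => ∀ v ∈ e, v ∉ A).card ≤ (X \ Y).card + 2 * (crossing H A).card := by
    intro A
    let X1 := (X \ Y).filter fun e => ∀ v ∈ e, v ∈ A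
    let Y1 := (Y \ X).filter fun e => ∀ v ∈ e, v ∉ A
    let cutTree : Sym2 V → Prop := fun e => ∃ u v, (t (grp e)).Adj u v ∧ u ∈ A ∧ v ∉ A
    have hX1 : X1 ⊆ X ∪ Y := fun e he => mem_union_left _ (mem_sdiff.1 (mem_filter.1 he).1).1
    have hY1 : Y1 ⊆ X ∪ Y := fun e he => mem_union_right _ (mem_sdiff.1 (mem_filter.1 he).1).1
    have hdisj : Disjoint X1 Y1 := disjoint_left.2 fun e he he' =>
      (mem_sdiff.1 (mem_filter.1 he).1).2 (mem_sdiff.1 (mem_filter.1 he').1).1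
    have htrees : ((X1 ∪ Y1).filter cutTree).card ≤ (crossing H A).card := by
      have : ∀ e ∈ (X1 ∪ Y1).filter cutTree,
          ∃ f, f ∈ crossing H A ∧ f ∈ (t (grp e)).edgeSet := by
        intro e he
        obtain ⟨heXY, u, v, huv, hu, hv⟩ := mem_filter.1 he
        have he' := union_subset hX1 hY1 heXY
        refine ⟨s(u, v), mem_crossing.2 ⟨mem_filter.2 ⟨SimpleGraph.mem_edgeFinset.2 huv.adj_sub,
          (htree _ (hgrp𝒢 e he')).2.2 _ huv, fun h => ?_⟩, u, v, rfl, hu, hv⟩, huv⟩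
        obtain rfl := hgrpinj e he' _ h _ huv (hself _ h)
        rcases mem_union.1 heXY with h | h
        · exact hv ((mem_filter.1 h).2 v (by simp))
        · exact (mem_filter.1 h).2 u (by simp) hu
      choose! φ hφ hφt using this
      refine card_le_card_of_injOn φ hφ fun e he d hd h => ?_
      have he' := union_subset hX1 hY1 (mem_filter.1 he).1
      have hd' := union_subset hX1 hY1 (mem_filter.1 hd).1
      exact hgrpinj e he' d hd' (φ e) (hφt e he) (h ▸ hφt d hd)
    have hgroups : ∀ (Z : Finset (Sym2 V)) (B : Finset V), Z ⊆ X ∪ Y →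
        (∀ e ∈ Z, ∀ v ∈ (t (grp e)).verts, v ∈ S → v ∈ B) → B ⊆ S →
        p * Z.card ≤ (Γ ∩ outF G B).card := by
      intro Z B hZ hZB hBS
      have h1 : (Z.biUnion fun e => U' (grp e)).card = p * Z.card := by
        rw [card_biUnion, sum_const_nat (fun e he => (hU' _ (hgrp𝒢 e (hZ he))).2.1), mul_comm]
        intro e he d hd hne
        refine disjoint_left.2 fun f hfe hfd => hne (hgrpinj e (hZ he) d (hZ hd) f ?_ ?_)
        · exact (htree _ (hgrp𝒢 e (hZ he))).2.1 ((hU' _ (hgrp𝒢 e (hZ he))).1 hfe)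
        · exact (htree _ (hgrp𝒢 d (hZ hd))).2.1 ((hU' _ (hgrp𝒢 d (hZ hd))).1 hfd)
      rw [← h1]
      refine card_le_card fun f hf => ?_
      obtain ⟨e, he, hfe⟩ := mem_biUnion.1 hf
      have hU := hgrp𝒢 e (hZ he)
      have hfU := (hU' _ hU).1 hfe
      have hfΓ := hmemΓ _ hU hfU
      obtain ⟨u, v, rfl, hu, hv⟩ := hΓS f hfΓ
      have hadj : (t (grp e)).Adj u v := (htree _ hU).2.1 hfU
      exact mem_inter.2 ⟨hfΓ, mem_filter.2 ⟨SimpleGraph.mem_edgeFinset.2 hadj.adj_sub, u, v, rfl,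
        hZB e he u hadj.fst_mem hu, fun h => hv (hBS h)⟩⟩
    have hvert : ∀ e ∈ X ∪ Y, ∃ a ∈ e, a ∈ (t (grp e)).verts := by
      intro e he
      have := hself e he
      induction e using Sym2.ind with | _ a b
      exact ⟨a, by simp, (show (t (grp s(a, b))).Adj a b from this).fst_mem⟩
    have hX2 : p * (X1.filter fun e => ¬ cutTree e).card ≤ (Γ ∩ outF G (A ∩ S)).card := by
      refine hgroups _ _ ((filter_subset _ _).trans hX1) (fun e he v hv hvS => ?_)
        inter_subset_right
      obtain ⟨he1, hnc⟩ := mem_filter.1 he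
      obtain ⟨a, hae, hat⟩ := hvert e (hX1 he1)
      have := (htree _ (hgrp𝒢 e (hX1 he1))).1.verts_subset_of_no_crossing (A := (A : Set V)) hat
        ((mem_filter.1 he1).2 a hae) fun u w huw hu => by
          by_contra hw
          exact hnc ⟨u, w, huw, hu, hw⟩
      exact mem_inter.2 ⟨this hv, hvS⟩
    have hY2 : p * (Y1.filter fun e => ¬ cutTree e).card ≤ (Γ ∩ outF G (S \ A)).card := by
      refine hgroups _ _ ((filter_subset _ _).trans hY1) (fun e he v hv hvS => ?_) sdiff_subset
      obtain ⟨he1, hnc⟩ := mem_filter.1 he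
      obtain ⟨a, hae, hat⟩ := hvert e (hY1 he1)
      have := (htree _ (hgrp𝒢 e (hY1 he1))).1.verts_subset_of_no_crossing (A := (A : Set V)ᶜ) hat
        ((mem_filter.1 he1).2 a hae) fun u w huw hu hw => hnc ⟨w, u, huw.symm, hw, hu⟩
      exact mem_sdiff.2 ⟨hvS, this hv⟩
    have hbetween : (betweenF G (A ∩ S) (S \ A)).card ≤ (crossing H A).card := by
      refine card_le_card fun f hf => ?_
      obtain ⟨hfG, u, v, rfl, hu, hv⟩ := mem_filter.1 hf
      rw [mem_inter] at hu
      rw [mem_sdiff] at hv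
      refine mem_crossing.2
        ⟨mem_filter.2 ⟨hfG, ⟨u, hu.2, by simp⟩, fun h => ?_⟩, u, v, rfl, hu.1, hv.2⟩
      obtain ⟨u', v', huv, hu', hv'⟩ := hΓS _ (hXYΓ h)
      rcases Sym2.eq_iff.1 huv with ⟨rfl, rfl⟩ | ⟨rfl, rfl⟩
      · exact hv' hv.1
      · exact hv' hu.2
    have hmin : min (X1.filter fun e => ¬ cutTree e).card (Y1.filter fun e => ¬ cutTree e).card ≤
        (crossing H A).card := by
      set x := (X1.filter fun e => ¬ cutTree e).card
      set y := (Y1.filter fun e => ¬ cutTree e).card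
      have hw := hwl (A ∩ S) (S \ A)
        (disjoint_left.2 fun v h1 h2 => (mem_sdiff.1 h2).2 (mem_inter.1 h1).1)
        (by ext v; simp only [mem_union, mem_inter, mem_sdiff]; tauto)
      have h1 : (p : ℝ) * (min x y : ℕ) ≤
          min ((Γ ∩ outF G (A ∩ S)).card : ℝ) ((Γ ∩ outF G (S \ A)).card : ℝ) := by
        refine le_min ?_ ?_
        · exact_mod_cast (Nat.mul_le_mul_left p (min_le_left x y)).trans hX2
        · exact_mod_cast (Nat.mul_le_mul_left p (min_le_right x y)).trans hY2
      have h2 : 1 ≤ α * p := by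
        rw [div_le_iff₀ hα] at hαp
        linarith
      have h3 : ((min x y : ℕ) : ℝ) ≤ ((crossing H A).card : ℝ) :=
        calc ((min x y : ℕ) : ℝ) ≤ α * p * (min x y : ℕ) := le_mul_of_one_le_left (by positivity) h2
          _ = α * (p * (min x y : ℕ)) := by ring
          _ ≤ _ := mul_le_mul_of_nonneg_left h1 hα.le
          _ ≤ _ := hw
          _ ≤ _ := by exact_mod_cast hbetween
      exact_mod_cast h3
    have h1 : (X1.filter cutTree).card + (X1.filter fun e => ¬ cutTree e).card = X1.card :=
      card_filter_add_card_filter_not _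
    have h2 : (Y1.filter cutTree).card + (Y1.filter fun e => ¬ cutTree e).card = Y1.card :=
      card_filter_add_card_filter_not _
    have h3 : X1.card ≤ (X \ Y).card := card_filter_le _ _
    have h4 : Y1.card ≤ (Y \ X).card := card_filter_le _ _
    rw [filter_union, card_union_of_disjoint (disjoint_filter_filter hdisj)] at htrees
    change X1.card + Y1.card ≤ _
    omega
  obtain ⟨g, es, hg, hP, hcong⟩ := exists_trails_of_cut (G := G) (H := H) (X := X \ Y) (Y := Y \ X)
    hHG (fun e he => hXG e (mem_union_left _ (mem_sdiff.1 he).1))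
    (fun e he => hXG e (mem_union_right _ (mem_sdiff.1 he).1))
    (disjoint_left.2 fun e h1 h2 => (mem_sdiff.1 h1).2 (mem_sdiff.1 h2).1) hcard hcut
  let g' : Sym2 V → Sym2 V := fun e => if e ∈ Y then e else g e
  have hgsub : ∀ e ∈ X, e ∉ Y → g e ∈ Y ∧ g e ∉ X := fun e he heY =>
    mem_sdiff.1 (hP e (mem_sdiff.2 ⟨he, heY⟩)).1
  have hg' : Set.InjOn g' X := by
    intro e he d hd h
    have he : e ∈ X := he
    have hd : d ∈ X := hd
    by_cases h1 : e ∈ Y <;> by_cases h2 : d ∈ Y <;> simp only [g', h1, h2, if_true, if_false] at h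
    · exact h
    · exact absurd (h ▸ he) (hgsub d hd h2).2
    · exact absurd (h ▸ hd) (hgsub e he h1).2
    · exact hg (mem_sdiff.2 ⟨he, h1⟩) (mem_sdiff.2 ⟨hd, h2⟩) h
  have hg'Y : X.image g' = Y := by
    refine eq_of_subset_of_card_le (fun f hf => ?_) (by rw [card_image_of_injOn hg', hXYcard])
    obtain ⟨e, he, rfl⟩ := mem_image.1 hf
    by_cases h1 : e ∈ Y <;> simp only [g', h1, if_true, if_false]
    exact (hgsub e he h1).1
  let edges : Sym2 V → List (Sym2 V) := fun e => if e ∈ Y then [e] else e :: (es e ++ [g e])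
  have hwalk : ∀ e, ∃ P : Σ (u : V) (v : V), G.Walk u v, e ∈ X → P.2.2.edges = edges e := by
    intro e
    by_cases he : e ∈ X
    · by_cases heY : e ∈ Y
      · have := hXG e (mem_union_left _ he)
        induction e using Sym2.ind with | _ a b
        exact ⟨⟨a, b, .cons (G.mem_edgeSet.1 this) .nil⟩, fun _ => by simp [edges, heY]⟩
      · obtain ⟨-, -, -, u, v, q, hq⟩ := hP e (mem_sdiff.2 ⟨he, heY⟩)
        exact ⟨⟨u, v, q⟩, fun _ => by simp [edges, heY, hq]⟩
    · exact ⟨⟨e.out.1, e.out.1, .nil⟩, fun h => absurd h he⟩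
  choose P hPedges using hwalk
  have hHXY : ∀ f ∈ H, f ∉ X ∧ f ∉ Y := fun f hf => by
    have := (mem_filter.1 hf).2.2
    rwa [mem_union, not_or] at this
  have hXYS : ∀ e ∈ X ∪ Y, ∃ x ∈ S, x ∈ e := fun e he => by
    obtain ⟨u, v, rfl, hu, -⟩ := hΓS e (hXYΓ he)
    exact ⟨u, hu, by simp⟩
  refine ⟨g', hg', hg'Y, P, fun e he => ?_, fun f => ?_⟩
  · rw [hPedges e he]
    by_cases heY : e ∈ Y
    · simpa [edges, g', heY] using hXYS e (mem_union_left _ he)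
    · obtain ⟨hgY, hnd, hH, -⟩ := hP e (mem_sdiff.2 ⟨he, heY⟩)
      obtain ⟨hgY, hgX⟩ := mem_sdiff.1 hgY
      simp only [edges, g', heY, if_false]
      refine ⟨rfl, by simp [List.getLast?_cons], ?_, fun f hf => ?_⟩
      · refine List.nodup_cons.2 ⟨fun h => ?_, List.nodup_append.2 ⟨hnd, by simp, ?_⟩⟩
        · rcases List.mem_append.1 h with h | h
          · exact (hHXY _ (hH e h)).1 he
          · exact heY (List.mem_singleton.1 h ▸ hgY)
        · rintro a ha b hb rfl
          exact (hHXY _ (hH a ha)).2 (List.mem_singleton.1 hb ▸ hgY)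
      · simp only [List.mem_cons, List.mem_append, List.not_mem_nil, or_false] at hf
        rcases hf with rfl | hf | rfl
        · exact hXYS f (mem_union_left _ he)
        · exact (mem_filter.1 (hH f hf)).2.1
        · exact hXYS _ (mem_union_right _ hgY)
  · have hmem : ∀ e ∈ X, f ∈ (P e).2.2.edges → e = f ∨ (e ∉ Y ∧ (f ∈ es e ∨ g e = f)) := by
      intro e he hf
      rw [hPedges e he] at hf
      by_cases heY : e ∈ Y
      · simp only [edges, heY, if_true, List.mem_singleton] at hf
        exact .inl hf.symm
      · simp only [edges, heY, if_false, List.mem_cons, List.mem_append, List.not_mem_nil,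
          or_false] at hf
        rcases hf with h | h | h
        exacts [.inl h.symm, .inr ⟨heY, .inl h⟩, .inr ⟨heY, .inr h.symm⟩]
    by_cases hfH : f ∈ H
    · refine le_trans (card_le_card fun e he => ?_) (hcong f)
      obtain ⟨heX, hf⟩ := mem_filter.1 he
      rcases hmem e heX hf with rfl | ⟨heY, h | rfl⟩
      · exact absurd heX (hHXY _ hfH).1
      · exact mem_filter.2 ⟨mem_sdiff.2 ⟨heX, heY⟩, h⟩
      · exact absurd (hgsub e heX heY).1 (hHXY _ hfH).2
    · have hsub : (X.filter fun e => f ∈ (P e).2.2.edges) ⊆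
          {f} ∪ (X \ Y).filter fun e => g e = f := fun e he => by
        obtain ⟨heX, hf⟩ := mem_filter.1 he
        rcases hmem e heX hf with rfl | ⟨heY, h | h⟩
        · simp
        · exact absurd ((hP e (mem_sdiff.2 ⟨heX, heY⟩)).2.2.1 f h) hfH
        · exact mem_union_right _ (mem_filter.2 ⟨mem_sdiff.2 ⟨heX, heY⟩, h⟩)
      have hone : ((X \ Y).filter fun e => g e = f).card ≤ 1 := card_le_one.2 fun e he d hd => by
        obtain ⟨he, h1⟩ := mem_filter.1 he
        obtain ⟨hd, h2⟩ := mem_filter.1 hd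
        exact hg he hd (h1.trans h2.symm)
      have := (card_le_card hsub).trans (card_union_le _ _)
      simp only [card_singleton] at this
      omega
end
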